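/- arXiv:1310.0665 — 3 statements merged into one kernel-verified Lean document; each statement's English description precedes it below -/
import Mathlib

section
/- Define a sequence (p_ℓ)_{ℓ≥0} of real numbers by p_0 = 1 and p_ℓ = 1/(2 - p_{ℓ-1}) - 1/2 for ℓ ≥ 1. Then for every ℓ ≥ 0, p_ℓ = 3/(4^ℓ + 2). In particular p_1 = 1/2, p_2 = 1/6, p_3 = 1/22, and p_4 = 1/86. -/
/-- For uniformly random ordered trees, the limiting proportions `p_ℓ` of `ℓ`-protected
nodes, defined by `p_0 = 1` and `p_ℓ = 1/(2 - p_{ℓ-1}) - 1/2`, satisfy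
`p_ℓ = 3/(4^ℓ + 2)`; in particular `p_1 = 1/2`, `p_2 = 1/6`, `p_3 = 1/22`, `p_4 = 1/86`. -/
theorem stmt8 (p : ℕ → ℝ) (h0 : p 0 = 1)
    (hrec : ∀ ℓ : ℕ, 1 ≤ ℓ → p ℓ = 1 / (2 - p (ℓ - 1)) - 1 / 2) :
    (∀ ℓ : ℕ, p ℓ = 3 / (4 ^ ℓ + 2)) ∧
    p 1 = 1 / 2 ∧ p 2 = 1 / 6 ∧ p 3 = 1 / 22 ∧ p 4 = 1 / 86 := by
  have key : ∀ ℓ : ℕ, p ℓ = 3 / (4 ^ ℓ + 2) := by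
    intro ℓ
    induction ℓ with
    | zero => rw [h0]; norm_num
    | succ k ih =>
      rw [hrec (k + 1) (by omega), Nat.add_sub_cancel, ih, pow_succ]
      have hx : (0 : ℝ) < 4 ^ k := by positivity
      generalize (4 : ℝ) ^ k = x at hx
      have h1 : x + 2 ≠ 0 := by positivity
      have h2 : 2 * x + 1 ≠ 0 := by positivity
      have h3 : x * 4 + 2 ≠ 0 := by positivity
      have h4 : 2 - 3 / (x + 2) = (2 * x + 1) / (x + 2) := by
        field_simp
        ring
      rw [h4, one_div_div, div_sub_div _ _ h2 two_ne_zero,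
        div_eq_div_iff (mul_ne_zero h2 two_ne_zero) h3]
      ring
  refine ⟨key, ?_, ?_, ?_, ?_⟩ <;> rw [key] <;> norm_num
end

section
/- Define functions q_ℓ, r_ℓ : [0,∞) → ℝ by q_1(t) = e^{-2t}, and recursively for ℓ ≥ 2: r_{ℓ-1}(t) = e^{-t}·∫_0^t q_{ℓ-1}(s) e^{s} ds and q_ℓ(t) = q_1(t) + 2 r_{ℓ-1}(t) - r_{ℓ-1}(t)^2. Then 1 - ∫_0^∞ q_3(t) e^{-t} dt = 1249/8100. -/
open Real MeasureTheory intervalIntegral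

/-- `f` is integrable on the positive half-line with integral `v`. -/
def HasInt (f : ℝ → ℝ) (v : ℝ) : Prop :=
  IntegrableOn f (Set.Ioi 0) ∧ ∫ t in Set.Ioi (0 : ℝ), f t = v

theorem HasInt.add {f g : ℝ → ℝ} {v w : ℝ} (hf : HasInt f v) (hg : HasInt g w) :
    HasInt (fun t => f t + g t) (v + w) :=
  ⟨Integrable.add hf.1 hg.1, by
    rw [MeasureTheory.integral_add hf.1 hg.1, hf.2, hg.2]⟩

theorem hasInt_term (n k : ℕ) (c : ℝ) (hk : 0 < k) :
    HasInt (fun t => c * (t ^ n * exp (-t) ^ k)) (c * (n.factorial / (k : ℝ) ^ (n + 1))) := by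
  have hk' : (0 : ℝ) < k := by exact_mod_cast hk
  have h1 : ∫ t in Set.Ioi (0 : ℝ), t ^ n * exp (-t) ^ k
      = n.factorial / (k : ℝ) ^ (n + 1) := by
    have h := Real.integral_rpow_mul_exp_neg_mul_Ioi (a := (n : ℝ) + 1) (r := k)
      (by positivity) hk'
    rw [Real.Gamma_nat_eq_factorial] at h
    have e : ((1 : ℝ) / k) ^ ((n : ℝ) + 1) = 1 / (k : ℝ) ^ (n + 1) := by
      rw [show (n : ℝ) + 1 = ((n + 1 : ℕ) : ℝ) by push_cast; ring, Real.rpow_natCast]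
      rw [div_pow, one_pow]
    rw [e] at h
    rw [show (n.factorial : ℝ) / (k : ℝ) ^ (n + 1) = 1 / (k : ℝ) ^ (n + 1) * n.factorial by ring,
      ← h]
    refine setIntegral_congr_fun measurableSet_Ioi fun t _ => ?_
    simp only [add_sub_cancel_right, Real.rpow_natCast]
    rw [← Real.exp_nat_mul]
    ring_nf
  have h2 : IntegrableOn (fun t : ℝ => t ^ n * exp (-t) ^ k) (Set.Ioi 0) := by
    by_contra hcon
    have h3 := MeasureTheory.integral_undef hcon
    rw [h1] at h3
    have : (0 : ℝ) < n.factorial / (k : ℝ) ^ (n + 1) := by positivity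
    linarith
  exact ⟨Integrable.const_mul h2 c, by rw [MeasureTheory.integral_const_mul, h1]⟩

/-- For the continuous-time binary tree growth process of random binary search trees,
with `q_1(t) = e^{-2t}`, `r_{ℓ-1}(t) = e^{-t} ∫_0^t q_{ℓ-1}(s) e^s ds` and
`q_ℓ(t) = q_1(t) + 2r_{ℓ-1}(t) - r_{ℓ-1}(t)^2`, the limiting proportion of 3-protected
nodes is `1 - ∫_0^∞ q_3(t) e^{-t} dt = 1249/8100`. -/
theorem stmt11 (q r : ℕ → ℝ → ℝ)
    (hq1 : ∀ t : ℝ, q 1 t = exp (-2 * t))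
    (hr : ∀ ℓ : ℕ, 2 ≤ ℓ → ∀ t : ℝ,
      r (ℓ - 1) t = exp (-t) * ∫ s in (0 : ℝ)..t, q (ℓ - 1) s * exp s)
    (hq : ∀ ℓ : ℕ, 2 ≤ ℓ → ∀ t : ℝ,
      q ℓ t = q 1 t + 2 * r (ℓ - 1) t - (r (ℓ - 1) t) ^ 2) :
    1 - ∫ t in Set.Ioi (0 : ℝ), q 3 t * exp (-t) = 1249 / 8100 := by
  have e2 : ∀ t : ℝ, exp (-2 * t) = exp (-t) ^ 2 := fun t => by
    rw [← Real.exp_nat_mul]; congr 1; push_cast; ring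
  have ee : ∀ t : ℝ, exp (-t) * exp t = 1 := fun t => by
    rw [← Real.exp_add]; simp
  have hd : ∀ t : ℝ, HasDerivAt (fun s : ℝ => exp (-s)) (-exp (-t)) t := fun t => by
    simpa using (hasDerivAt_neg t).exp
  have r1 : ∀ t, r 1 t = exp (-t) - exp (-t) ^ 2 := fun t => by
    have h := hr 2 le_rfl t
    norm_num at h
    rw [h]
    have : ∫ s in (0 : ℝ)..t, q 1 s * exp s = 1 - exp (-t) := by
      rw [intervalIntegral.integral_eq_sub_of_hasDerivAt (f := fun s => -exp (-s))]
      · simp; ring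
      · intro s _
        convert (hd s).neg using 1
        · rfl
        rw [hq1, e2]
        linear_combination exp (-s) * ee s
      · apply Continuous.intervalIntegrable
        simp only [hq1]
        fun_prop
    rw [this]; ring
  have q2 : ∀ t, q 2 t = 2 * exp (-t) - 2 * exp (-t) ^ 2 + 2 * exp (-t) ^ 3 - exp (-t) ^ 4 :=
    fun t => by
      have h := hq 2 le_rfl t
      norm_num at h
      rw [h, r1, hq1, e2]; ring
  have r2 : ∀ t, r 2 t = exp (-t) * (2 * t - 4 / 3 + 2 * exp (-t) - exp (-t) ^ 2
      + exp (-t) ^ 3 / 3) := fun t => by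
    have h := hr 3 (by norm_num) t
    norm_num at h
    rw [h]
    congr 1
    rw [intervalIntegral.integral_eq_sub_of_hasDerivAt
      (f := fun s => 2 * s + 2 * exp (-s) - exp (-s) ^ 2 + exp (-s) ^ 3 / 3)]
    · simp; ring
    · intro s _
      convert ((((hasDerivAt_id s).const_mul 2).add ((hd s).const_mul 2)).sub
        ((hd s).pow 2)).add (((hd s).pow 3).div_const 3) using 1
      · rfl
      rw [q2]
      push_cast
      linear_combination (2 - 2 * exp (-s) + 2 * exp (-s) ^ 2 - exp (-s) ^ 3) * ee s
    · apply Continuous.intervalIntegrable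
      simp only [q2]
      fun_prop
  have key := ((((((((((((((hasInt_term 2 3 (-4) (by norm_num)).add
    (hasInt_term 1 2 (4) (by norm_num))).add
    (hasInt_term 1 3 (16/3) (by norm_num))).add
    (hasInt_term 1 4 (-8) (by norm_num))).add
    (hasInt_term 1 5 (4) (by norm_num))).add
    (hasInt_term 1 6 (-4/3) (by norm_num))).add
    (hasInt_term 0 2 (-8/3) (by norm_num))).add
    (hasInt_term 0 3 (29/9) (by norm_num))).add
    (hasInt_term 0 4 (10/3) (by norm_num))).add
    (hasInt_term 0 5 (-6) (by norm_num))).add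
    (hasInt_term 0 6 (44/9) (by norm_num))).add
    (hasInt_term 0 7 (-7/3) (by norm_num))).add
    (hasInt_term 0 8 (2/3) (by norm_num))).add
    (hasInt_term 0 9 (-1/9) (by norm_num)))
  have hv := key.2
  have hc : ∀ t, q 3 t * exp (-t) = _ := fun t => by
    have h := hq 3 (by norm_num) t
    norm_num at h
    rw [h, r2, hq1, e2]
  simp only [hc]
  have : ∀ a b : ℝ, a = b → b = 6851 / 8100 → 1 - a = 1249 / 8100 := by
    intro a b h1 h2; rw [h1, h2]; norm_num
  refine this _ _ (Eq.trans ?_ hv) ?_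
  · refine setIntegral_congr_fun measurableSet_Ioi fun t _ => ?_
    ring
  · norm_num [Nat.factorial]
end

section
/- Define functions q_ℓ, r_ℓ : [0,∞) → ℝ by q_1(t) = e^{-2t}, and recursively for ℓ ≥ 2: r_{ℓ-1}(t) = e^{-t}·∫_0^t q_{ℓ-1}(s) e^{s} ds and q_ℓ(t) = q_1(t) + 2 r_{ℓ-1}(t) - r_{ℓ-1}(t)^2. Then 1 - ∫_0^∞ q_4(t) e^{-t} dt = 103365591157608217/2294809143026400000. -/
open Real MeasureTheory intervalIntegral

/-- A finite sum of terms `c * t^a * exp(-t)^b`. -/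
noncomputable def ev : List (ℝ × ℕ × ℕ) → ℝ → ℝ
  | [], _ => 0
  | m :: L, t => m.1 * t ^ m.2.1 * exp (-t) ^ m.2.2 + ev L t

noncomputable def dv : List (ℝ × ℕ × ℕ) → ℝ → ℝ
  | [], _ => 0
  | m :: L, t => (m.1 * (m.2.1 * t ^ (m.2.1 - 1)) * exp (-t) ^ m.2.2
      - m.1 * t ^ m.2.1 * (m.2.2 * exp (-t) ^ m.2.2)) + dv L t

noncomputable def iv : List (ℝ × ℕ × ℕ) → ℝ
  | [] => 0
  | m :: L => m.1 * (m.2.1.factorial / (m.2.2 : ℝ) ^ (m.2.1 + 1)) + iv L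

lemma exp_pow_hasDeriv (b : ℕ) (t : ℝ) :
    HasDerivAt (fun t : ℝ => exp (-t) ^ b) (-(b * exp (-t) ^ b)) t := by
  have h : (fun t : ℝ => exp (-t) ^ b) = fun t => exp (-(b * t)) := by
    funext s
    rw [← Real.exp_nat_mul]; congr 1; ring
  have h2 := congrFun h t
  rw [h2, h]
  have h3 := (((hasDerivAt_id t).const_mul (b : ℝ)).neg).exp
  simp only [id] at h3
  refine HasDerivAt.congr_deriv (f := fun t => exp (-(b * t))) h3 ?_
  change exp (-((b : ℝ) * t)) * -((b : ℝ) * 1) = _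
  ring

lemma ev_hasDeriv (L : List (ℝ × ℕ × ℕ)) (t : ℝ) : HasDerivAt (ev L) (dv L t) t := by
  induction L with
  | nil => exact hasDerivAt_const t 0
  | cons m L ih =>
    have h := (((hasDerivAt_pow m.2.1 t).const_mul m.1).mul (exp_pow_hasDeriv m.2.2 t)).add ih
    refine h.congr_deriv ?_
    simp only [dv]; ring

lemma dv_cont (L : List (ℝ × ℕ × ℕ)) : Continuous (dv L) := by
  induction L with
  | nil => exact continuous_const
  | cons m L ih => 
    have e : dv (m :: L) = fun t => (m.1 * (m.2.1 * t ^ (m.2.1 - 1)) * exp (-t) ^ m.2.2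
      - m.1 * t ^ m.2.1 * (m.2.2 * exp (-t) ^ m.2.2)) + dv L t := rfl
    rw [e]
    fun_prop

lemma ftc (L : List (ℝ × ℕ × ℕ)) (f : ℝ → ℝ) (hf : ∀ s, f s = dv L s) (h0 : ev L 0 = 0) (t : ℝ) :
    ∫ s in (0 : ℝ)..t, f s = ev L t := by
  have hf' : f = dv L := funext hf
  rw [hf', integral_eq_sub_of_hasDerivAt (fun x _ => ev_hasDeriv L x)
    ((dv_cont L).intervalIntegrable _ _), h0, sub_zero]

lemma term_int (a b : ℕ) (hb : 0 < b) :
    IntegrableOn (fun t : ℝ => t ^ a * exp (-t) ^ b) (Set.Ioi 0) ∧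
    ∫ t in Set.Ioi (0 : ℝ), t ^ a * exp (-t) ^ b = a.factorial / (b : ℝ) ^ (a + 1) := by
  have hb' : (0 : ℝ) < b := by exact_mod_cast hb
  have e : ∀ t : ℝ, t ^ a * exp (-t) ^ b = t ^ (((a : ℝ) + 1) - 1) * exp (-(b * t)) := by
    intro t
    rw [← Real.exp_nat_mul, add_sub_cancel_right, Real.rpow_natCast]
    congr 2; ring
  have hi : ∫ t in Set.Ioi (0 : ℝ), t ^ a * exp (-t) ^ b = a.factorial / (b : ℝ) ^ (a + 1) := by
    simp_rw [e]
    rw [Real.integral_rpow_mul_exp_neg_mul_Ioi (by positivity) hb', Real.Gamma_nat_eq_factorial]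
    have : ((a : ℝ) + 1) = ((a + 1 : ℕ) : ℝ) := by push_cast; ring
    rw [this, Real.rpow_natCast, one_div, inv_pow]
    ring
  refine ⟨?_, hi⟩
  by_contra hn
  rw [integral_undef hn] at hi
  have : (0 : ℝ) < a.factorial / (b : ℝ) ^ (a + 1) := by positivity
  linarith

lemma ev_int (L : List (ℝ × ℕ × ℕ)) (hL : ∀ m ∈ L, 0 < m.2.2) :
    IntegrableOn (ev L) (Set.Ioi 0) ∧ ∫ t in Set.Ioi (0 : ℝ), ev L t = iv L := by
  induction L with
  | nil =>
    constructor
    · exact integrableOn_zero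
    · simp [ev, iv]
  | cons m L ih =>
    obtain ⟨i1, i2⟩ := ih (fun x hx => hL x (List.mem_cons_of_mem _ hx))
    obtain ⟨j1, j2⟩ := term_int m.2.1 m.2.2 (hL m List.mem_cons_self)
    have j3 := j1.const_mul m.1
    have e : ev (m :: L) = fun t => m.1 * (t ^ m.2.1 * exp (-t) ^ m.2.2) + ev L t := by
      funext t; simp only [ev]; ring
    rw [e]
    refine ⟨j3.add i1, ?_⟩
    rw [MeasureTheory.integral_add j3 i1, MeasureTheory.integral_const_mul, j2, i2, iv]

/-- For the continuous-time binary tree growth process of random binary search trees,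
with `q_1(t) = e^{-2t}`, `r_{ℓ-1}(t) = e^{-t} ∫_0^t q_{ℓ-1}(s) e^s ds` and
`q_ℓ(t) = q_1(t) + 2r_{ℓ-1}(t) - r_{ℓ-1}(t)^2`, the limiting proportion of 4-protected
nodes is `1 - ∫_0^∞ q_4(t) e^{-t} dt = 103365591157608217/2294809143026400000`. -/
theorem stmt12 (q r : ℕ → ℝ → ℝ)
    (hq1 : ∀ t : ℝ, q 1 t = exp (-2 * t))
    (hr : ∀ ℓ : ℕ, 2 ≤ ℓ → ∀ t : ℝ,
      r (ℓ - 1) t = exp (-t) * ∫ s in (0 : ℝ)..t, q (ℓ - 1) s * exp s)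
    (hq : ∀ ℓ : ℕ, 2 ≤ ℓ → ∀ t : ℝ,
      q ℓ t = q 1 t + 2 * r (ℓ - 1) t - (r (ℓ - 1) t) ^ 2) :
    1 - ∫ t in Set.Ioi (0 : ℝ), q 4 t * exp (-t)
      = 103365591157608217 / 2294809143026400000 := by
  
  have hx : ∀ t : ℝ, exp t = (exp (-t))⁻¹ := fun t => by rw [Real.exp_neg, inv_inv]
  have q1 : ∀ t, q 1 t = exp (-t) ^ 2 := fun t => by
    rw [hq1, ← Real.exp_nat_mul]; congr 1; push_cast; ring
  have r1 : ∀ t, r 1 t = exp (-t) * ev [(1, 0, 0), (-1, 0, 1)] t := fun t => by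
    have h := hr 2 (by norm_num) t
    simp only [show 2 - 1 = 1 from rfl] at h
    rw [h]
    congr 1
    refine ftc _ _ (fun s => ?_) ?_ t
    · rw [q1, hx s]
      have hp : exp (-s) ≠ 0 := (Real.exp_pos _).ne'
      simp only [ev, dv]
      generalize exp (-s) = x at hp
      push_cast
      field_simp
      ring
    · simp only [ev]; norm_num
  have q2 : ∀ t, q 2 t = exp (-t) ^ 2 + 2 * r 1 t - (r 1 t) ^ 2 := fun t => by
    rw [hq 2 (by norm_num) t, q1]
  simp only [r1] at q2
  have r2 : ∀ t, r 2 t = exp (-t) * ev [(-4/3, 0, 0), (2, 0, 1), (-1, 0, 2), (1/3, 0, 3), (2, 1, 0)] t := fun t => by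
    have h := hr 3 (by norm_num) t
    simp only [show 3 - 1 = 2 from rfl] at h
    rw [h]
    congr 1
    refine ftc _ _ (fun s => ?_) ?_ t
    · rw [q2, hx s]
      have hp : exp (-s) ≠ 0 := (Real.exp_pos _).ne'
      simp only [ev, dv]
      generalize exp (-s) = x at hp
      push_cast
      field_simp
      ring
    · simp only [ev]; norm_num
  have q3 : ∀ t, q 3 t = exp (-t) ^ 2 + 2 * r 2 t - (r 2 t) ^ 2 := fun t => by
    rw [hq 3 (by norm_num) t, q1]
  simp only [r2] at q3
  have r3 : ∀ t, r 3 t = exp (-t) * ev [(-713/1260, 0, 0), (-5/9, 0, 1), (1/3, 0, 2), (14/9, 0, 3), (-41/36, 0, 4), (7/15, 0, 5), (-1/9, 0, 6), (1/63, 0, 7), (-8/3, 1, 0), (8/3, 1, 1), (4, 1, 2), (-4/3, 1, 3), (1/3, 1, 4), (2, 2, 0), (4, 2, 1)] t := fun t => by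
    have h := hr 4 (by norm_num) t
    simp only [show 4 - 1 = 3 from rfl] at h
    rw [h]
    congr 1
    refine ftc _ _ (fun s => ?_) ?_ t
    · rw [q3, hx s]
      have hp : exp (-s) ≠ 0 := (Real.exp_pos _).ne'
      simp only [ev, dv]
      generalize exp (-s) = x at hp
      push_cast
      field_simp
      ring
    · simp only [ev]; norm_num
  have q4 : ∀ t, q 4 t = exp (-t) ^ 2 + 2 * r 3 t - (r 3 t) ^ 2 := fun t => by
    rw [hq 4 (by norm_num) t, q1]
  have fin : ∀ t, q 4 t * exp (-t) = ev [(-713/630, 0, 2), (-684769/1587600, 0, 3), (43/1134, 0, 4), (18029/5670, 0, 5), (-119/810, 0, 6), (5723/4536, 0, 7), (-4043/2025, 0, 8), (-1168/945, 0, 9), (8273/2646, 0, 10), (-40177/15120, 0, 11), (7927/5670, 0, 12), (-2107/4050, 0, 13), (793/5670, 0, 14), (-11/405, 0, 15), (2/567, 0, 16), (-1/3969, 0, 17), (-16/3, 1, 2), (2188/945, 1, 3), (7612/945, 1, 4), (6238/945, 1, 5), (3188/315, 1, 6), (-11429/630, 1, 7), (-118/45, 1, 8), (448/45, 1, 9),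 (-2246/315, 1, 10), (1769/630, 1, 11), (-694/945, 1, 12), (22/189, 1, 13), (-2/189, 1, 14), (4, 2, 2), (331/105, 2, 3), (734/35, 2, 4), (52/3, 2, 5), (-112/3, 2, 6), (-15, 2, 7), (242/15, 2, 8), (-116/15, 2, 9), (12/7, 2, 10), (-5/21, 2, 11), (32/3, 3, 3), (32/3, 3, 4), (-112/3, 3, 5), (-80/3, 3, 6), (28/3, 3, 7), (-8/3, 3, 8), (-4, 4, 3), (-16, 4, 4), (-16, 4, 5)] t := fun t => by
    rw [q4, r3]
    simp only [ev]
    generalize exp (-t) = x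
    ring
  simp only [fin]
  rw [(ev_int _ (by simp)).2]
  simp only [iv, Nat.factorial]
  norm_num
end
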